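/- Let 𝒳 be a finite alphabet with a source distribution P_X, let ρ : 𝒳 × 𝒴 → ℝ be a distortion measure and d a distortion level, and let Q₁, Q₂ be probability distributions on 𝒴 with p(x,Q_i) := P_{Y∼Q_i}[ρ(x,Y) ≤ d] > 0 for all x ∈ 𝒳 and i = 1,2. Then the mean costs satisfy | b̃(Q₁) − b̃(Q₂) | ≤ μ(Q₁,Q₂), where b̃(Q) := E_{X∼P_X, 𝒞∼Q^{⊗∞}}[ log J(X,𝒞) ] and μ(Q₁,Q₂) := max_{x∈𝒳} | log( p(x,Q₁) / p(x,Q₂) ) |. In other words, Q ↦ b̃(Q) is 1-Lipschitz with respect to the metric μ. -/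

import Mathlib

open MeasureTheory

/-- The `d`-match probability `p(x,Q) = P_{Y∼Q}[ρ(x,Y) ≤ d]`. -/
noncomputable def matchProb {𝒳 𝒴 : Type*} [MeasurableSpace 𝒴]
    (ρ : 𝒳 → 𝒴 → ℝ) (d : ℝ) (Q : Measure 𝒴) (x : 𝒳) : ℝ :=
  (Q {y | ρ x y ≤ d}).toReal

/-- `μ(Q₁,Q₂) := max_{x∈𝒳} |log( p(x,Q₁) / p(x,Q₂) )|` over the finite alphabet `𝒳`. -/
noncomputable def matchMetric {𝒳 𝒴 : Type*} [Fintype 𝒳] [MeasurableSpace 𝒴]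
    (ρ : 𝒳 → 𝒴 → ℝ) (d : ℝ) (Q₁ Q₂ : Measure 𝒴) : ℝ :=
  ⨆ x : 𝒳, |Real.log (matchProb ρ d Q₁ x / matchProb ρ d Q₂ x)|

/-- The expected logarithm `E[log U]` of a Geometric(p) random variable `U` on `ℕ₊`. -/
noncomputable def geomLogMean (p : ℝ) : ℝ :=
  ∑' j : ℕ, p * (1 - p) ^ j * Real.log (j + 1)

/-- The mean cost `b̃(Q) = E_{X∼PX, 𝒞∼Q^⊗∞}[log J(X,𝒞)]`: since `J(x,𝒞)` is
Geometric(`p(x,Q)`), it equals `∑_x PX(x)·E[log Geometric(p(x,Q))]`. -/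
noncomputable def meanCost {𝒳 𝒴 : Type*} [Fintype 𝒳] [MeasurableSpace 𝒴]
    (PX : 𝒳 → ℝ) (ρ : 𝒳 → 𝒴 → ℝ) (d : ℝ) (Q : Measure 𝒴) : ℝ :=
  ∑ x, PX x * geomLogMean (matchProb ρ d Q x)

/-- Summation by parts turns `E[log U]`, `U ∼ Geometric(p)`, into a power series in `1 - p` with
nonnegative coefficients. -/
theorem hasSum_geomLogMean {p : ℝ} (hp : 0 < p) (hp1 : p ≤ 1) :
    HasSum (fun n : ℕ => (1 - p) ^ (n + 1) * (Real.log (n + 2) - Real.log (n + 1)))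
      (geomLogMean p) := by
  have hr0 : 0 ≤ 1 - p := by linarith
  have hr : ‖1 - p‖ < 1 := by rw [Real.norm_of_nonneg hr0]; linarith
  have hs : Summable fun n : ℕ => (1 - p) ^ n * Real.log (n + 1) := by
    refine Summable.of_nonneg_of_le (fun n => ?_) (fun n => ?_)
      (summable_pow_mul_geometric_of_norm_lt_one 1 hr)
    · have : 0 ≤ Real.log ((n : ℝ) + 1) := Real.log_nonneg (by linarith [n.cast_nonneg (α := ℝ)])
      positivity
    · have h := Real.log_le_sub_one_of_pos (n.cast_add_one_pos (α := ℝ))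
      rw [pow_one, mul_comm]
      exact mul_le_mul_of_nonneg_right (by linarith) (pow_nonneg hr0 n)
  obtain ⟨S, hS⟩ := hs
  have hshift : HasSum (fun n : ℕ => (1 - p) ^ (n + 1) * Real.log (n + 2)) S := by
    have h := (hasSum_nat_add_iff' 1).2 hS
    simp only [Finset.range_one, Finset.sum_singleton, Nat.cast_zero, zero_add, Real.log_one,
      mul_zero, sub_zero, Nat.cast_add, Nat.cast_one] at h
    simpa only [add_assoc, one_add_one_eq_two] using h
  have hval : geomLogMean p = S - (1 - p) * S := by
    have h := (hS.mul_left p).tsum_eq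
    simp only [← mul_assoc] at h
    rw [geomLogMean, h]
    ring
  rw [hval]
  convert! hshift.sub (hS.mul_left (1 - p)) using 1
  ext n
  ring

theorem geomLogMean_anti {p q : ℝ} (hp : 0 < p) (hpq : p ≤ q) (hq : q ≤ 1) :
    geomLogMean q ≤ geomLogMean p := by
  refine hasSum_le (fun n => ?_) (hasSum_geomLogMean (hp.trans_le hpq) hq)
    (hasSum_geomLogMean hp (hpq.trans hq))
  have hn := n.cast_add_one_pos (α := ℝ)
  have h := Real.log_le_log hn (by linarith : (n : ℝ) + 1 ≤ n + 2)
  exact mul_le_mul_of_nonneg_right (pow_le_pow_left₀ (by linarith) (by linarith) _) (by linarith)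

/-- `-log p - E[log U]` is a power series in `1 - p` with nonnegative coefficients
`1 / n - log (1 + 1 / n)`, so `E[log U] + log p` is monotone in `p`. -/
theorem geomLogMean_add_log_mono {p q : ℝ} (hp : 0 < p) (hpq : p ≤ q) (hq : q ≤ 1) :
    geomLogMean p + Real.log p ≤ geomLogMean q + Real.log q := by
  have key {s : ℝ} (hs : 0 < s) (hs1 : s ≤ 1) :
      HasSum (fun n : ℕ => (1 - s) ^ (n + 1) *
        (1 / ((n : ℝ) + 1) - (Real.log (n + 2) - Real.log (n + 1))))
        (-Real.log s - geomLogMean s) := by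
    have h := Real.hasSum_pow_div_log_of_abs_lt_one
      (show |1 - s| < 1 by rw [abs_of_nonneg (by linarith)]; linarith)
    rw [sub_sub_cancel] at h
    convert! h.sub (hasSum_geomLogMean hs hs1) using 1
    ext n
    ring
  have h := hasSum_le (fun n => ?_) (key (hp.trans_le hpq) hq) (key hp (hpq.trans hq))
  · linarith
  · have hn := n.cast_add_one_pos (α := ℝ)
    have hlog : Real.log ((n : ℝ) + 2) - Real.log (n + 1) ≤ 1 / ((n : ℝ) + 1) := by
      rw [← Real.log_div (by linarith) hn.ne']
      refine (Real.log_le_sub_one_of_pos (by positivity)).trans_eq ?_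
      field_simp
      ring
    exact mul_le_mul_of_nonneg_right (pow_le_pow_left₀ (by linarith) (by linarith) _)
      (by linarith)

theorem abs_geomLogMean_sub_le {p q : ℝ} (hp : 0 < p) (hp1 : p ≤ 1) (hq : 0 < q) (hq1 : q ≤ 1) :
    |geomLogMean p - geomLogMean q| ≤ |Real.log (p / q)| := by
  rw [Real.log_div hp.ne' hq.ne']
  rcases le_total p q with h | h
  · rw [abs_of_nonneg (sub_nonneg.2 (geomLogMean_anti hp h hq1)), abs_sub_comm]
    exact le_trans (by linarith [geomLogMean_add_log_mono hp h hq1]) (le_abs_self _)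
  · rw [abs_sub_comm, abs_of_nonneg (sub_nonneg.2 (geomLogMean_anti hq h hp1))]
    exact le_trans (by linarith [geomLogMean_add_log_mono hq h hp1]) (le_abs_self _)

theorem matchProb_le_one {𝒳 𝒴 : Type*} [MeasurableSpace 𝒴] (ρ : 𝒳 → 𝒴 → ℝ) (d : ℝ)
    (Q : Measure 𝒴) [IsProbabilityMeasure Q] (x : 𝒳) : matchProb ρ d Q x ≤ 1 :=
  measureReal_le_one

/-- the mean cost is 1-Lipschitz w.r.t. the metric `μ`:
`|b̃(Q₁) − b̃(Q₂)| ≤ μ(Q₁,Q₂) = max_x |log(p(x,Q₁)/p(x,Q₂))|`. -/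
theorem stmt9 {𝒳 𝒴 : Type*} [Fintype 𝒳] [Nonempty 𝒳] [MeasurableSpace 𝒴]
    (PX : 𝒳 → ℝ) (hPX : ∀ x, 0 ≤ PX x) (hPX1 : ∑ x, PX x = 1)
    (ρ : 𝒳 → 𝒴 → ℝ) (d : ℝ)
    (Q₁ Q₂ : Measure 𝒴) (_ : IsProbabilityMeasure Q₁) (_ : IsProbabilityMeasure Q₂)
    (h₁ : ∀ x, 0 < matchProb ρ d Q₁ x) (h₂ : ∀ x, 0 < matchProb ρ d Q₂ x) :
    |meanCost PX ρ d Q₁ - meanCost PX ρ d Q₂| ≤ matchMetric ρ d Q₁ Q₂ := by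
  unfold meanCost
  rw [← Finset.sum_sub_distrib]
  calc |∑ x, (PX x * geomLogMean (matchProb ρ d Q₁ x) - PX x * geomLogMean (matchProb ρ d Q₂ x))|
      ≤ ∑ x, |PX x * geomLogMean (matchProb ρ d Q₁ x) - PX x * geomLogMean (matchProb ρ d Q₂ x)| :=
        Finset.abs_sum_le_sum_abs _ _
    _ ≤ ∑ x, PX x * matchMetric ρ d Q₁ Q₂ := by
        refine Finset.sum_le_sum fun x _ => ?_
        rw [← mul_sub, abs_mul, abs_of_nonneg (hPX x)]
        refine mul_le_mul_of_nonneg_left ?_ (hPX x)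
        exact (abs_geomLogMean_sub_le (h₁ x) (matchProb_le_one ρ d Q₁ x) (h₂ x)
          (matchProb_le_one ρ d Q₂ x)).trans (le_ciSup
            (f := fun x => |Real.log (matchProb ρ d Q₁ x / matchProb ρ d Q₂ x)|)
            (Set.finite_range _).bddAbove x)
    _ = matchMetric ρ d Q₁ Q₂ := by rw [← Finset.sum_mul, hPX1, one_mul]
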